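/- arXiv:1304.3886 — 2 statements merged into one kernel-verified Lean document; each statement's English description precedes it below -/
import Mathlib

section
/- (Sparse CRB, non-full-support case.) Consider the SLGM and assume every set of at most S columns of H is linearly independent (spark(H) > S). Let x₀ ∈ X_S with |supp(x₀)| ≤ S − 1, and let ĝ : ℝ^M → ℝ be Borel measurable, P_x-integrable for every x ∈ X_S, with ∫ ĝ² dP_{x₀} < ∞; write γ(x) = ∫ ĝ dP_x for x ∈ X_S. Suppose that for each l ∈ {1,…,N} the map t ↦ γ(x₀ + t e_l) (whose argument lies in X_S for all t) is differentiable at t = 0, with derivative b_l; set b = (b₁,…,b_N) ∈ ℝ^N. Let G ∈ ℝ^{N×N} be any matrix satisfying the four Moore–Penrose conditions for A = HᵀH, namely A G A = A, G A G = G, (A G)ᵀ = A G, and (G A)ᵀ = G A. Then v(ĝ; x₀) ≥ σ² · bᵀ G b. -/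
open Matrix MeasureTheory ProbabilityTheory

/-- The distribution `P_x` of `y = Hx + n` where `n` has i.i.d. `N(0,σ²)` entries. -/
noncomputable def slgmP {M N : ℕ} (H : Matrix (Fin M) (Fin N) ℝ) (σ : ℝ)
    (x : Fin N → ℝ) : Measure (Fin M → ℝ) :=
  Measure.map (fun n => H.mulVec x + n)
    (Measure.pi fun _ : Fin M => gaussianReal 0 ((σ ^ 2).toNNReal))

/-- The set `X_S` of `S`-sparse parameter vectors. -/
def sparseSet (N S : ℕ) : Set (Fin N → ℝ) := {x | (Function.support x).ncard ≤ S}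

/-- Mean function `γ_ĝ(x) = ∫ ĝ dP_x` of an estimator. -/
noncomputable def slgmMean {M N : ℕ} (H : Matrix (Fin M) (Fin N) ℝ) (σ : ℝ)
    (g : (Fin M → ℝ) → ℝ) (x : Fin N → ℝ) : ℝ := ∫ y, g y ∂ slgmP H σ x

/-- Variance `v(ĝ;x) = ∫ (ĝ(y) − γ_ĝ(x))² dP_x(y)` of an estimator. -/
noncomputable def slgmVar {M N : ℕ} (H : Matrix (Fin M) (Fin N) ℝ) (σ : ℝ)
    (g : (Fin M → ℝ) → ℝ) (x : Fin N → ℝ) : ℝ :=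
  ∫ y, (g y - slgmMean H σ g x) ^ 2 ∂ slgmP H σ x

open scoped NNReal ENNReal

/-- The Cauchy–Schwarz inequality for covariances. -/
lemma sq_covariance_le_variance_mul_variance {Ω : Type*} [MeasurableSpace Ω] {μ : Measure Ω}
    [IsProbabilityMeasure μ] {X Y : Ω → ℝ} (hX : MemLp X 2 μ) (hY : MemLp Y 2 μ) :
    cov[X, Y; μ] ^ 2 ≤ Var[X; μ] * Var[Y; μ] := by
  have key : ∀ r : ℝ, 0 ≤ Var[Y; μ] * (r * r) + 2 * cov[X, Y; μ] * r + Var[X; μ] := by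
    intro r
    have h := variance_nonneg (X + r • Y) μ
    rw [variance_add hX (hY.const_smul r), variance_smul, covariance_smul_right] at h
    linarith
  have := discrim_le_zero key
  rw [discrim] at this
  linarith

/-- A product of probability measures with densities has the product density. -/
lemma pi_withDensity {ι : Type*} [Fintype ι] {X : ι → Type*} [∀ i, MeasurableSpace (X i)]
    (μ : ∀ i, Measure (X i)) [∀ i, IsProbabilityMeasure (μ i)]
    {f : ∀ i, X i → ℝ≥0∞} (hf : ∀ i, Measurable (f i))
    [∀ i, SigmaFinite ((μ i).withDensity (f i))] :
    Measure.pi (fun i => (μ i).withDensity (f i)) =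
      (Measure.pi μ).withDensity (fun x => ∏ i, f i (x i)) := by
  refine Measure.pi_eq fun s hs => ?_
  have hind : ∀ x : ∀ i, X i, (Set.univ.pi s).indicator (fun x => ∏ i, f i (x i)) x =
      ∏ i, (s i).indicator (f i) (x i) := by
    intro x
    by_cases hx : x ∈ Set.univ.pi s
    · rw [Set.indicator_of_mem hx]
      exact Finset.prod_congr rfl fun i _ => (Set.indicator_of_mem (hx i trivial) _).symm
    · rw [Set.indicator_of_notMem hx]
      simp only [Set.mem_univ_pi, not_forall] at hx
      obtain ⟨i, hi⟩ := hx
      exact (Finset.prod_eq_zero (Finset.mem_univ i) (Set.indicator_of_notMem hi _)).symm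
  have hm : ∀ i, Measurable ((s i).indicator (f i)) := fun i => (hf i).indicator (hs i)
  rw [withDensity_apply _ (MeasurableSet.univ_pi hs),
    ← lintegral_indicator (MeasurableSet.univ_pi hs)]
  simp_rw [hind]
  rw [lintegral_prod_eq_prod_lintegral_of_indepFun Finset.univ
    (fun i (x : ∀ i, X i) => (s i).indicator (f i) (x i))
    (iIndepFun_pi fun i => (hm i).aemeasurable) (fun i => (hm i).comp (measurable_pi_apply i))]
  refine Finset.prod_congr rfl fun i _ => ?_
  rw [withDensity_apply _ (hs i), ← lintegral_indicator (hs i)]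
  exact (measurePreserving_eval μ i).lintegral_comp (hm i)

/-- Density of a shifted Gaussian with respect to the centered one. -/
lemma gaussianReal_eq_withDensity_centered (u : ℝ) {v : ℝ≥0} (hv : v ≠ 0) :
    gaussianReal u v = (gaussianReal 0 v).withDensity
      (fun x => ENNReal.ofReal (Real.exp (u * x / v - u * u / (2 * v)))) := by
  rw [gaussianReal_of_var_ne_zero _ hv, gaussianReal_of_var_ne_zero _ hv,
    ← withDensity_mul _ (measurable_gaussianPDF 0 v) (by fun_prop)]
  congr 1
  ext x
  have hv' : (v : ℝ) ≠ 0 := by exact_mod_cast hv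
  simp only [Pi.mul_apply, gaussianPDF]
  rw [← ENNReal.ofReal_mul (gaussianPDFReal_nonneg _ _ _)]
  simp only [gaussianPDFReal, mul_assoc]
  rw [← Real.exp_add]
  congr 4
  field_simp
  ring

section GaussianShift

variable {ι : Type*} [Fintype ι]

/-- The likelihood ratio between isotropic Gaussians with means `u` and `0`. -/
noncomputable def gaussianShiftDensity (v : ℝ≥0) (u n : ι → ℝ) : ℝ :=
  Real.exp (u ⬝ᵥ n / v - u ⬝ᵥ u / (2 * v))

lemma measurable_gaussianShiftDensity (v : ℝ≥0) (u : ι → ℝ) :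
    Measurable (gaussianShiftDensity v u) := by
  unfold gaussianShiftDensity dotProduct
  fun_prop

lemma map_const_add_pi_gaussianReal {v : ℝ≥0} (hv : v ≠ 0) (u : ι → ℝ) :
    (Measure.pi fun _ : ι => gaussianReal 0 v).map (fun n => u + n) =
      (Measure.pi fun _ : ι => gaussianReal 0 v).withDensity
        (fun n => ENNReal.ofReal (gaussianShiftDensity v u n)) := by
  have h1 : (Measure.pi fun _ : ι => gaussianReal 0 v).map (fun n => u + n) =
      Measure.pi (fun i => gaussianReal (u i) v) := by
    have := Measure.pi_map_pi (μ := fun _ : ι => gaussianReal 0 v)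
      (f := fun i (x : ℝ) => u i + x) (fun i => by fun_prop)
    simp only [gaussianReal_map_const_add, zero_add] at this
    exact this
  have h2 : ∀ i, gaussianReal (u i) v = (gaussianReal 0 v).withDensity
      (fun x => ENNReal.ofReal (Real.exp (u i * x / v - u i * u i / (2 * v)))) :=
    fun i => gaussianReal_eq_withDensity_centered (u i) hv
  have : ∀ i, SigmaFinite ((gaussianReal 0 v).withDensity
      (fun x => ENNReal.ofReal (Real.exp (u i * x / v - u i * u i / (2 * v))))) := fun i => by
    rw [← h2]; infer_instance
  rw [h1]
  simp_rw [h2]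
  rw [pi_withDensity _ fun i => by fun_prop]
  congr 1
  ext n
  rw [← ENNReal.ofReal_prod_of_nonneg fun i _ => (Real.exp_pos _).le, ← Real.exp_sum]
  simp only [gaussianShiftDensity, dotProduct, Finset.sum_sub_distrib, Finset.sum_div]

lemma integral_const_add_pi_gaussianReal {v : ℝ≥0} (hv : v ≠ 0) (u : ι → ℝ)
    {f : (ι → ℝ) → ℝ} (hf : Measurable f) :
    ∫ n, f (u + n) ∂(Measure.pi fun _ : ι => gaussianReal 0 v) =
      ∫ n, f n * gaussianShiftDensity v u n ∂(Measure.pi fun _ : ι => gaussianReal 0 v) := by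
  rw [← integral_map (φ := fun n => u + n) (by fun_prop) hf.aestronglyMeasurable,
    map_const_add_pi_gaussianReal hv u, integral_withDensity_eq_integral_toReal_smul
      (measurable_gaussianShiftDensity v u).ennreal_ofReal (by simp)]
  refine integral_congr_ae (.of_forall fun n => ?_)
  simp only [smul_eq_mul]
  rw [ENNReal.toReal_ofReal (show 0 ≤ gaussianShiftDensity v u n from (Real.exp_pos _).le),
    mul_comm]

lemma integrable_exp_dotProduct_pi_gaussianReal (v : ℝ≥0) (w : ι → ℝ) :
    Integrable (fun n => Real.exp (w ⬝ᵥ n)) (Measure.pi fun _ : ι => gaussianReal 0 v) := by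
  simp only [dotProduct, Real.exp_sum]
  exact Integrable.fintype_prod (f := fun i (x : ℝ) => Real.exp (w i * x))
    fun i => integrable_exp_mul_gaussianReal (w i)

lemma integral_exp_dotProduct_pi_gaussianReal (v : ℝ≥0) (w : ι → ℝ) :
    ∫ n, Real.exp (w ⬝ᵥ n) ∂(Measure.pi fun _ : ι => gaussianReal 0 v) =
      Real.exp (v * (w ⬝ᵥ w) / 2) := by
  simp only [dotProduct, Real.exp_sum]
  rw [integral_fintype_prod_eq_prod (fun i (x : ℝ) => Real.exp (w i * x))]
  have : ∀ i, ∫ x, Real.exp (w i * x) ∂gaussianReal 0 v = Real.exp (v * w i ^ 2 / 2) := by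
    intro i
    have := congrFun (mgf_fun_id_gaussianReal (μ := 0) (v := v)) (w i)
    simpa [mgf] using this
  simp_rw [this]
  rw [← Real.exp_sum, Finset.mul_sum, Finset.sum_div]
  simp only [pow_two]

lemma gaussianShiftDensity_mul (v : ℝ≥0) (u w n : ι → ℝ) :
    gaussianShiftDensity v u n * gaussianShiftDensity v w n =
      Real.exp (((v : ℝ)⁻¹ • (u + w)) ⬝ᵥ n) * Real.exp (-(u ⬝ᵥ u + w ⬝ᵥ w) / (2 * v)) := by
  simp only [gaussianShiftDensity]
  rw [← Real.exp_add, ← Real.exp_add]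
  congr 1
  rw [smul_dotProduct, add_dotProduct, smul_eq_mul]
  ring

lemma memLp_gaussianShiftDensity (v : ℝ≥0) (u : ι → ℝ) :
    MemLp (gaussianShiftDensity v u) 2 (Measure.pi fun _ : ι => gaussianReal 0 v) := by
  rw [memLp_two_iff_integrable_sq (measurable_gaussianShiftDensity v u).aestronglyMeasurable]
  simp only [pow_two, gaussianShiftDensity_mul]
  exact (integrable_exp_dotProduct_pi_gaussianReal v _).mul_const _

lemma integral_gaussianShiftDensity_mul {v : ℝ≥0} (hv : v ≠ 0) (u w : ι → ℝ) :
    ∫ n, gaussianShiftDensity v u n * gaussianShiftDensity v w n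
      ∂(Measure.pi fun _ : ι => gaussianReal 0 v) = Real.exp (u ⬝ᵥ w / v) := by
  have hv' : (v : ℝ) ≠ 0 := by exact_mod_cast hv
  simp only [gaussianShiftDensity_mul]
  rw [integral_mul_const, integral_exp_dotProduct_pi_gaussianReal, ← Real.exp_add]
  congr 1
  simp only [smul_dotProduct, dotProduct_smul, add_dotProduct, dotProduct_add, smul_eq_mul,
    dotProduct_comm w u]
  field_simp
  ring

lemma integral_gaussianShiftDensity {v : ℝ≥0} (hv : v ≠ 0) (u : ι → ℝ) :
    ∫ n, gaussianShiftDensity v u n ∂(Measure.pi fun _ : ι => gaussianReal 0 v) = 1 := by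
  simpa [gaussianShiftDensity] using integral_gaussianShiftDensity_mul hv u 0

lemma covariance_gaussianShiftDensity {v : ℝ≥0} (hv : v ≠ 0) (u w : ι → ℝ) :
    cov[gaussianShiftDensity v u, gaussianShiftDensity v w;
      Measure.pi fun _ : ι => gaussianReal 0 v] = Real.exp (u ⬝ᵥ w / v) - 1 := by
  rw [covariance_eq_sub (memLp_gaussianShiftDensity v u) (memLp_gaussianShiftDensity v w),
    integral_gaussianShiftDensity hv, integral_gaussianShiftDensity hv, mul_one,
    ← integral_gaussianShiftDensity_mul hv u w]
  rfl

lemma covariance_gaussianShiftDensity_right {v : ℝ≥0} (hv : v ≠ 0) (u : ι → ℝ)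
    {f : (ι → ℝ) → ℝ} (hfm : Measurable f)
    (hf : MemLp f 2 (Measure.pi fun _ : ι => gaussianReal 0 v)) :
    cov[f, gaussianShiftDensity v u; Measure.pi fun _ : ι => gaussianReal 0 v] =
      ∫ n, f (u + n) ∂(Measure.pi fun _ : ι => gaussianReal 0 v) -
        ∫ n, f n ∂(Measure.pi fun _ : ι => gaussianReal 0 v) := by
  rw [covariance_eq_sub hf (memLp_gaussianShiftDensity v u), integral_gaussianShiftDensity hv,
    mul_one, integral_const_add_pi_gaussianReal hv u hfm]
  rfl

/-- The Hammersley–Chapman–Robbins inequality for Gaussian shifts. -/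
lemma sq_sum_gaussianShift_le {κ : Type*} [Fintype κ] {v : ℝ≥0} (hv : v ≠ 0)
    (u : κ → ι → ℝ) (a : κ → ℝ) {f : (ι → ℝ) → ℝ} (hfm : Measurable f)
    (hf : MemLp f 2 (Measure.pi fun _ : ι => gaussianReal 0 v)) :
    (∑ k, a k * (∫ n, f (u k + n) ∂(Measure.pi fun _ : ι => gaussianReal 0 v) -
        ∫ n, f n ∂(Measure.pi fun _ : ι => gaussianReal 0 v))) ^ 2 ≤
      Var[f; Measure.pi fun _ : ι => gaussianReal 0 v] *
        ∑ k, ∑ l, a k * a l * (Real.exp (u k ⬝ᵥ u l / v) - 1) := by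
  have hL : ∀ k, MemLp (a k • gaussianShiftDensity v (u k)) 2
      (Measure.pi fun _ : ι => gaussianReal 0 v) :=
    fun k => (memLp_gaussianShiftDensity v (u k)).const_smul (a k)
  have h := sq_covariance_le_variance_mul_variance hf (memLp_finsetSum' Finset.univ fun k _ => hL k)
  rw [← covariance_self
      (memLp_finsetSum' Finset.univ fun k _ => hL k).aestronglyMeasurable.aemeasurable,
    covariance_sum_right hL hf, covariance_sum_sum hL hL] at h
  simpa only [mul_left_comm (a _) (a _), covariance_smul_left, covariance_smul_right, covariance_gaussianShiftDensity hv,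
    covariance_gaussianShiftDensity_right hv _ hfm hf, mul_assoc] using h

/-- The Cramér–Rao inequality for the mean of an isotropic Gaussian, along the directions `h k`. -/
lemma sq_sum_deriv_gaussianShift_le {κ : Type*} [Fintype κ] {v : ℝ≥0} (hv : v ≠ 0)
    (h : κ → ι → ℝ) (a b : κ → ℝ) {f : (ι → ℝ) → ℝ} (hfm : Measurable f)
    (hf : MemLp f 2 (Measure.pi fun _ : ι => gaussianReal 0 v))
    (hder : ∀ k, HasDerivAt (fun t : ℝ =>
      ∫ n, f (t • h k + n) ∂(Measure.pi fun _ : ι => gaussianReal 0 v)) (b k) 0) :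
    (∑ k, a k * b k) ^ 2 ≤ Var[f; Measure.pi fun _ : ι => gaussianReal 0 v] *
        ∑ k, ∑ l, a k * a l * (h k ⬝ᵥ h l / v) := by
  have hlim : ∀ c : ℝ, Filter.Tendsto (fun t : ℝ => (t ^ 2)⁻¹ * (Real.exp (t ^ 2 * c) - 1))
      (nhdsWithin 0 {0}ᶜ) (nhds c) := by
    intro c
    have h1 : HasDerivAt (fun s : ℝ => Real.exp (s * c)) c 0 := by
      simpa using ((hasDerivAt_id (0 : ℝ)).mul_const c).exp
    have h2 : Filter.Tendsto (fun t : ℝ => t ^ 2) (nhdsWithin 0 {0}ᶜ) (nhdsWithin 0 {0}ᶜ) := by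
      refine tendsto_nhdsWithin_iff.2 ⟨?_, ?_⟩
      · exact ((continuous_pow 2).tendsto' (0 : ℝ) 0 (by simp)).mono_left nhdsWithin_le_nhds
      · filter_upwards [self_mem_nhdsWithin] with t ht using pow_ne_zero 2 ht
    simpa [Function.comp_def] using (hasDerivAt_iff_tendsto_slope_zero.1 h1).comp h2
  have hleft : Filter.Tendsto (fun t : ℝ => (∑ k, a k * (t⁻¹ *
      (∫ n, f (t • h k + n) ∂(Measure.pi fun _ : ι => gaussianReal 0 v) -
        ∫ n, f n ∂(Measure.pi fun _ : ι => gaussianReal 0 v)))) ^ 2)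
      (nhdsWithin 0 {0}ᶜ) (nhds ((∑ k, a k * b k) ^ 2)) := by
    refine (tendsto_finsetSum _ fun k _ => Filter.Tendsto.const_mul _ ?_).pow 2
    simpa using hasDerivAt_iff_tendsto_slope_zero.1 (hder k)
  have hright : Filter.Tendsto (fun t : ℝ => Var[f; Measure.pi fun _ : ι => gaussianReal 0 v] *
      ∑ k, ∑ l, a k * a l * ((t ^ 2)⁻¹ * (Real.exp (t ^ 2 * (h k ⬝ᵥ h l / v)) - 1)))
      (nhdsWithin 0 {0}ᶜ) (nhds (Var[f; Measure.pi fun _ : ι => gaussianReal 0 v] *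
        ∑ k, ∑ l, a k * a l * (h k ⬝ᵥ h l / v))) :=
    Filter.Tendsto.const_mul _ (tendsto_finsetSum _ fun k _ => tendsto_finsetSum _ fun l _ =>
      Filter.Tendsto.const_mul _ (hlim _))
  refine le_of_tendsto_of_tendsto' hleft hright fun t => ?_
  have key := mul_le_mul_of_nonneg_left
    (sq_sum_gaussianShift_le hv (fun k => t • h k) a hfm hf) (sq_nonneg t⁻¹)
  rw [← mul_pow, Finset.mul_sum, mul_left_comm, Finset.mul_sum] at key
  simp only [Finset.mul_sum] at key ⊢
  convert key using 3 with k
  · ring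
  · rename_i k _ l _
    have : t ^ 2 * (h k ⬝ᵥ h l / v) = (t • h k) ⬝ᵥ (t • h l) / v := by
      simp only [smul_dotProduct, dotProduct_smul, smul_eq_mul]
      ring
    rw [this]
    ring

end GaussianShift

/-- A Moore–Penrose inverse `G` of a symmetric matrix `A` satisfies `Gᵀ A G = G`. -/
lemma transpose_mul_mul_of_moorePenrose {n R : Type*} [Fintype n] [CommRing R]
    {A G : Matrix n n R} (hA : Aᵀ = A) (h1 : A * G * A = A) (h2 : G * A * G = G)
    (h3 : (A * G)ᵀ = A * G) (h4 : (G * A)ᵀ = G * A) : Gᵀ * A * G = G := by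
  have h3' : Gᵀ * A = A * G := by rw [← h3, transpose_mul, hA]
  have h4' : A * Gᵀ = G * A := by rw [← h4, transpose_mul, hA]
  have h1' : A * Gᵀ * A = A := by
    have := congrArg transpose h1
    rwa [transpose_mul, transpose_mul, hA, ← Matrix.mul_assoc] at this
  have e1 : A * G = G * A * (A * G) := by
    conv_lhs => rw [← h1', h4', Matrix.mul_assoc]
  have e2 : G * A = G * A * (A * G) := by
    conv_lhs => rw [← h1', Matrix.mul_assoc A, h3', ← Matrix.mul_assoc]
  rw [h3', e1, ← e2, h2]

/-- Sparse CRB, non-full-support case. If every set of at most `S`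
columns of `H` is linearly independent, `|supp(x₀)| ≤ S − 1`, the mean function of a
finite-variance estimator `ĝ` has partial derivatives `b_l` at `x₀` along all directions
`e_l`, and `G` satisfies the four Moore–Penrose conditions for `A = HᵀH`, then
`v(ĝ;x₀) ≥ σ² bᵀ G b`. -/
theorem sparse_crb_nonfull_support {N M S : ℕ} (hN : 1 ≤ N) (hM : 1 ≤ M)
    (hS1 : 1 ≤ S) (hSN : S ≤ N)
    (H : Matrix (Fin M) (Fin N) ℝ) (σ : ℝ) (hσ : 0 < σ)
    (hspark : ∀ K : Finset (Fin N), K.card ≤ S →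
      LinearIndependent ℝ (fun k : ↥K => fun m => H m k.1))
    (x₀ : Fin N → ℝ) (hx₀S : (Function.support x₀).ncard ≤ S - 1)
    (g : (Fin M → ℝ) → ℝ) (hg : Measurable g)
    (hint : ∀ x ∈ sparseSet N S, Integrable g (slgmP H σ x))
    (hsq : Integrable (fun y => g y ^ 2) (slgmP H σ x₀))
    (b : Fin N → ℝ)
    (hder : ∀ l : Fin N, HasDerivAt
      (fun t : ℝ => slgmMean H σ g (x₀ + t • (Pi.single l (1:ℝ) : Fin N → ℝ))) (b l) 0)
    (G : Matrix (Fin N) (Fin N) ℝ)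
    (hG1 : Hᵀ * H * G * (Hᵀ * H) = Hᵀ * H)
    (hG2 : G * (Hᵀ * H) * G = G)
    (hG3 : (Hᵀ * H * G)ᵀ = Hᵀ * H * G)
    (hG4 : (G * (Hᵀ * H))ᵀ = G * (Hᵀ * H)) :
    σ ^ 2 * ∑ k, ∑ l, b k * G k l * b l ≤ slgmVar H σ g x₀ := by
  set v : NNReal := (σ ^ 2).toNNReal with hvdef
  have hσ2 : 0 < σ ^ 2 := by positivity
  have hv : v ≠ 0 := by simpa [hvdef] using hσ.ne'
  have hvσ : (v : ℝ) = σ ^ 2 := Real.coe_toNNReal _ hσ2.le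
  set μ : Measure (Fin M → ℝ) := Measure.pi fun _ : Fin M => gaussianReal 0 v with hμ
  set f : (Fin M → ℝ) → ℝ := fun n => g (H.mulVec x₀ + n) with hfdef
  have hfm : Measurable f := hg.comp (by fun_prop)
  have hmean : ∀ x, slgmMean H σ g x = ∫ n, g (H.mulVec x + n) ∂μ := fun x =>
    integral_map (by fun_prop) hg.aestronglyMeasurable
  have hf : MemLp f 2 μ := by
    rw [memLp_two_iff_integrable_sq hfm.aestronglyMeasurable]
    exact (integrable_map_measure (hg.pow_const 2).aestronglyMeasurable (by fun_prop)).1 hsq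
  have hvar : slgmVar H σ g x₀ = Var[f; μ] := by
    rw [variance_eq_integral hfm.aemeasurable, slgmVar, hmean, slgmP,
      integral_map (by fun_prop) ((hg.sub_const _).pow_const 2).aestronglyMeasurable]
  have hder' : ∀ k, HasDerivAt (fun t : ℝ => ∫ n, f (t • Hᵀ k + n) ∂μ) (b k) 0 := by
    intro k
    convert hder k using 2 with t
    rw [hmean]
    refine integral_congr_ae (.of_forall fun n => ?_)
    simp only [hfdef]
    rw [mulVec_add, mulVec_smul, mulVec_single_one, add_assoc]
    rfl
  have key := sq_sum_deriv_gaussianShift_le hv (fun k => Hᵀ k) (G *ᵥ b) b hfm hf hder'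
  have hGG := transpose_mul_mul_of_moorePenrose (by simp) hG1 hG2 hG3 hG4
  have hq : ∑ k, ∑ l, b k * G k l * b l = b ⬝ᵥ G *ᵥ b := by
    simp only [dotProduct, mulVec, Finset.mul_sum, mul_assoc]
  have hquad : (H *ᵥ (G *ᵥ b)) ⬝ᵥ (H *ᵥ (G *ᵥ b)) = b ⬝ᵥ G *ᵥ b := by
    conv_rhs => rw [← hGG]
    simp only [← mulVec_mulVec, Matrix.mul_assoc]
    rw [dotProduct_mulVec b, vecMul_transpose, dotProduct_mulVec (G *ᵥ b), vecMul_transpose]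
  have hsum : ∑ k, ∑ l, (G *ᵥ b) k * (G *ᵥ b) l * (Hᵀ k ⬝ᵥ Hᵀ l / v) =
      (b ⬝ᵥ G *ᵥ b) / σ ^ 2 := by
    have hquad' : (H *ᵥ (G *ᵥ b)) ⬝ᵥ (H *ᵥ (G *ᵥ b)) =
        ∑ k, ∑ l, (G *ᵥ b) k * (G *ᵥ b) l * (Hᵀ k ⬝ᵥ Hᵀ l) := by
      rw [mulVec_eq_sum]
      simp only [sum_dotProduct, dotProduct_sum, op_smul_eq_smul, smul_dotProduct,
        dotProduct_smul, smul_eq_mul, mul_assoc, Finset.mul_sum]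
      exact Finset.sum_congr rfl fun k _ => Finset.sum_congr rfl fun l _ => by
        rw [dotProduct_comm]
    rw [← hquad, hquad', hvσ]
    simp only [Finset.sum_div, mul_div_assoc]
  have hnonneg : 0 ≤ b ⬝ᵥ G *ᵥ b := by
    rw [← hquad]
    exact Finset.sum_nonneg fun i _ => mul_self_nonneg _
  have hab : ∑ k, (G *ᵥ b) k * b k = b ⬝ᵥ G *ᵥ b := dotProduct_comm _ _
  rw [hab, hsum] at key
  rw [hq, hvar]
  rcases hnonneg.eq_or_lt with h0 | hpos
  · rw [← h0, mul_zero]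
    exact variance_nonneg f μ
  · rw [← mul_div_assoc, le_div_iff₀ hσ2] at key
    nlinarith
end

section
/- (Novel CRB-type bound for the SSNM.) Consider the SSNM. Let x₀ ∈ X_S and let K ⊆ {1,…,N} be nonempty with |K| ≤ S. Let x₀^K ∈ ℝ^N denote the vector obtained from x₀ by zeroing all entries except those indexed by K. Let ĝ : ℝ^N → ℝ be Borel measurable, P_x-integrable for every x ∈ X_S, with ∫ ĝ² dP_{x₀} < ∞; write γ(x) = ∫ ĝ dP_x for x ∈ X_S. Suppose that for each l ∈ K the map t ↦ γ(x₀^K + t e_l) is differentiable at t = 0 with derivative b_l. Then v(ĝ; x₀) ≥ exp(−(1/σ²) · Σ_{l∉K} (x₀)_l²) · [σ² · Σ_{l∈K} b_l² + γ(x₀^K)²] − γ(x₀)². -/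
open MeasureTheory ProbabilityTheory

/-- The distribution `P_x` of `y = x + n` where `n` has i.i.d. `N(0,σ²)` entries
(sparse signal in noise model, SSNM). -/
noncomputable def ssnmP {N : ℕ} (σ : ℝ) (x : Fin N → ℝ) : Measure (Fin N → ℝ) :=
  Measure.map (fun n => x + n)
    (Measure.pi fun _ : Fin N => gaussianReal 0 ((σ ^ 2).toNNReal))

/-- Mean function `γ_ĝ(x) = ∫ ĝ dP_x` of an estimator. -/
noncomputable def ssnmMean {N : ℕ} (σ : ℝ) (g : (Fin N → ℝ) → ℝ) (x : Fin N → ℝ) : ℝ :=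
  ∫ y, g y ∂ ssnmP σ x

/-- Variance `v(ĝ;x) = ∫ (ĝ(y) − γ_ĝ(x))² dP_x(y)` of an estimator. -/
noncomputable def ssnmVar {N : ℕ} (σ : ℝ) (g : (Fin N → ℝ) → ℝ) (x : Fin N → ℝ) : ℝ :=
  ∫ y, (g y - ssnmMean σ g x) ^ 2 ∂ ssnmP σ x

open Filter Topology

/-- The likelihood ratio `dP_{x+h} / dP_x` of Gaussian product measures with variance `V`. -/
noncomputable def shiftDensity {N : ℕ} (V : ℝ) (x h y : Fin N → ℝ) : ℝ :=
  Real.exp ((∑ i, (h i * (y i - x i) - h i ^ 2 / 2)) / V)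

lemma shiftDensity_pos {N : ℕ} (V : ℝ) (x h y : Fin N → ℝ) : 0 < shiftDensity V x h y :=
  Real.exp_pos _

@[fun_prop]
lemma measurable_shiftDensity {N : ℕ} (V : ℝ) (x h : Fin N → ℝ) :
    Measurable (shiftDensity V x h) := by
  unfold shiftDensity
  fun_prop

lemma shiftDensity_eq_prod {N : ℕ} (V : ℝ) (x h y : Fin N → ℝ) :
    shiftDensity V x h y = ∏ i, Real.exp ((h i * (y i - x i) - h i ^ 2 / 2) / V) := by
  rw [shiftDensity, Finset.sum_div, Real.exp_sum]

lemma shiftDensity_mul {N : ℕ} (V : ℝ) (x h k y : Fin N → ℝ) :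
    shiftDensity V x h y * shiftDensity V x k y =
      Real.exp ((∑ i, h i * k i) / V) * shiftDensity V x (h + k) y := by
  simp only [shiftDensity, ← Real.exp_add, ← add_div, ← Finset.sum_add_distrib]
  congr 2
  refine Finset.sum_congr rfl fun i _ => ?_
  simp only [Pi.add_apply]
  ring

lemma gaussianReal_add_eq_withDensity (m h : ℝ) {v : NNReal} (hv : v ≠ 0) :
    gaussianReal (m + h) v = (gaussianReal m v).withDensity
      fun y => ENNReal.ofReal (Real.exp ((h * (y - m) - h ^ 2 / 2) / v)) := by
  rw [gaussianReal_of_var_ne_zero _ hv, gaussianReal_of_var_ne_zero _ hv,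
    ← withDensity_mul _ (measurable_gaussianPDF _ _) (by fun_prop)]
  congr 1
  ext y
  have hv' : (v : ℝ) ≠ 0 := by exact_mod_cast hv
  simp only [gaussianPDF_def, Pi.mul_apply]
  rw [← ENNReal.ofReal_mul (gaussianPDFReal_nonneg _ _ _), gaussianPDFReal, gaussianPDFReal,
    mul_assoc _ (Real.exp _), ← Real.exp_add]
  congr 3
  field_simp
  ring

lemma integrable_exp_gaussianReal_shift (m h : ℝ) (v : NNReal) :
    Integrable (fun y => Real.exp ((h * (y - m) - h ^ 2 / 2) / v)) (gaussianReal m v) := by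
  have := (integrable_exp_mul_gaussianReal (μ := m) (v := v) (h / v)).mul_const
    (Real.exp ((-(h * m) - h ^ 2 / 2) / v))
  refine this.congr (.of_forall fun y => ?_)
  simp only [← Real.exp_add]
  congr 1
  ring

lemma ssnmP_eq_pi {N : ℕ} (σ : ℝ) (x : Fin N → ℝ) :
    ssnmP σ x = Measure.pi fun i => gaussianReal (x i) ((σ ^ 2).toNNReal) := by
  have h := Measure.pi_map_pi (μ := fun _ : Fin N => gaussianReal 0 ((σ ^ 2).toNNReal))
    (f := fun i n => x i + n) (fun i => by fun_prop)
  simp only [gaussianReal_map_const_add, zero_add] at h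
  exact h

instance {N : ℕ} (σ : ℝ) (x : Fin N → ℝ) : IsProbabilityMeasure (ssnmP σ x) := by
  rw [ssnmP_eq_pi]
  infer_instance

lemma ssnmP_add {N : ℕ} {σ : ℝ} (hσ : 0 < σ) (x h : Fin N → ℝ) :
    ssnmP σ (x + h) = (ssnmP σ x).withDensity
      fun y => ENNReal.ofReal (shiftDensity (σ ^ 2) x h y) := by
  have hv : (σ ^ 2).toNNReal ≠ 0 := by simp [hσ.ne']
  have hV : (((σ ^ 2).toNNReal : NNReal) : ℝ) = σ ^ 2 := Real.coe_toNNReal _ (by positivity)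
  rw [ssnmP_eq_pi, ssnmP_eq_pi]
  refine Measure.pi_eq fun s hs => ?_
  rw [withDensity_apply _ (.univ_pi hs), Measure.restrict_pi_pi]
  have hi (i) : Integrable (fun y => Real.exp ((h i * (y - x i) - h i ^ 2 / 2) / σ ^ 2))
      ((gaussianReal (x i) ((σ ^ 2).toNNReal)).restrict (s i)) := by
    have := integrable_exp_gaussianReal_shift (x i) (h i) ((σ ^ 2).toNNReal)
    rw [hV] at this
    exact this.restrict
  simp only [shiftDensity_eq_prod]
  rw [← ofReal_integral_eq_lintegral_ofReal (Integrable.fintype_prod_dep hi)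
      (.of_forall fun y => Finset.prod_nonneg fun i _ => (Real.exp_pos _).le),
    integral_fintype_prod_eq_prod
      (f := fun i y => Real.exp ((h i * (y - x i) - h i ^ 2 / 2) / σ ^ 2)),
    ENNReal.ofReal_prod_of_nonneg
      (fun i _ => integral_nonneg fun y => (Real.exp_pos _).le)]
  refine Finset.prod_congr rfl fun i _ => ?_
  rw [ofReal_integral_eq_lintegral_ofReal (hi i) (.of_forall fun y => (Real.exp_pos _).le),
    Pi.add_apply, gaussianReal_add_eq_withDensity _ _ hv, withDensity_apply _ (hs i), hV]

lemma integral_ssnmP_add {N : ℕ} {σ : ℝ} (hσ : 0 < σ) (x h : Fin N → ℝ)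
    (f : (Fin N → ℝ) → ℝ) :
    ∫ y, f y ∂ssnmP σ (x + h) = ∫ y, f y * shiftDensity (σ ^ 2) x h y ∂ssnmP σ x := by
  rw [ssnmP_add hσ, integral_withDensity_eq_integral_toReal_smul (by fun_prop) (by simp)]
  refine integral_congr_ae (.of_forall fun y => ?_)
  simp [ENNReal.toReal_ofReal (shiftDensity_pos _ _ _ _).le, mul_comm]

lemma integrable_shiftDensity {N : ℕ} {σ : ℝ} (hσ : 0 < σ) (x h : Fin N → ℝ) :
    Integrable (shiftDensity (σ ^ 2) x h) (ssnmP σ x) := by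
  have h1 : Integrable (fun _ => (1 : ℝ)) (ssnmP σ (x + h)) := integrable_const _
  rw [ssnmP_add hσ, integrable_withDensity_iff_integrable_smul' (by fun_prop) (by simp)] at h1
  refine h1.congr (.of_forall fun y => ?_)
  simp [ENNReal.toReal_ofReal (shiftDensity_pos _ _ _ _).le]

lemma integral_shiftDensity_mul {N : ℕ} {σ : ℝ} (hσ : 0 < σ) (x h k : Fin N → ℝ) :
    ∫ y, shiftDensity (σ ^ 2) x h y * shiftDensity (σ ^ 2) x k y ∂ssnmP σ x =
      Real.exp ((∑ i, h i * k i) / σ ^ 2) := by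
  have h1 := integral_ssnmP_add hσ x (h + k) fun _ => 1
  simp only [integral_const, probReal_univ, smul_eq_mul, mul_one, one_mul] at h1
  simp only [shiftDensity_mul, integral_const_mul, ← h1, mul_one]

lemma memLp_shiftDensity {N : ℕ} {σ : ℝ} (hσ : 0 < σ) (x h : Fin N → ℝ) :
    MemLp (shiftDensity (σ ^ 2) x h) 2 (ssnmP σ x) := by
  rw [memLp_two_iff_integrable_sq (by fun_prop)]
  simp only [sq (shiftDensity _ _ _ _), shiftDensity_mul]
  exact (integrable_shiftDensity hσ x (h + h)).const_mul _

/-- Bessel's inequality for finitely many orthogonal square-integrable functions. -/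
lemma sum_sq_integral_mul_div_le {Ω ι : Type*} [MeasurableSpace Ω] {μ : Measure Ω}
    {f : Ω → ℝ} (hf : MemLp f 2 μ) {w : ι → Ω → ℝ} (s : Finset ι)
    (hw : ∀ i, MemLp (w i) 2 μ)
    (horth : ∀ i ∈ s, ∀ j ∈ s, i ≠ j → ∫ y, w i y * w j y ∂μ = 0) :
    ∑ i ∈ s, (∫ y, f y * w i y ∂μ) ^ 2 / (∫ y, w i y * w i y ∂μ) ≤ ∫ y, f y ^ 2 ∂μ := by
  set a : ι → ℝ := fun i => ∫ y, f y * w i y ∂μ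
  set q : ι → ℝ := fun i => ∫ y, w i y * w i y ∂μ
  set c : ι → ℝ := fun i => a i / q i
  set p : Ω → ℝ := fun y => ∑ i ∈ s, c i * w i y
  have hmul {u v : Ω → ℝ} (hu : MemLp u 2 μ) (hv : MemLp v 2 μ) :
      Integrable (fun y => u y * v y) μ := hu.integrable_mul hv
  have hp : MemLp p 2 μ := memLp_finsetSum s fun i _ => (hw i).const_mul (c i)
  have hfp : ∫ y, f y * p y ∂μ = ∑ i ∈ s, c i * a i := by
    simp only [p, Finset.mul_sum, mul_left_comm (f _)]
    rw [integral_finsetSum _ fun i _ => (hmul hf (hw i)).const_mul (c i)]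
    simp only [integral_const_mul, a]
  have hwp (i) (hi : i ∈ s) : ∫ y, w i y * p y ∂μ = c i * q i := by
    simp only [p, Finset.mul_sum, mul_left_comm (w i _)]
    rw [integral_finsetSum _ fun j _ => (hmul (hw i) (hw j)).const_mul (c j)]
    simp only [integral_const_mul]
    refine Finset.sum_eq_single_of_mem i hi fun j hj hji => ?_
    rw [horth i hi j hj hji.symm, mul_zero]
  have hpp : ∫ y, p y * p y ∂μ = ∑ i ∈ s, c i * (c i * q i) := by
    rw [← Finset.sum_congr rfl fun i hi => congrArg (c i * ·) (hwp i hi)]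
    simp only [← integral_const_mul]
    rw [← integral_finsetSum _ fun i _ => (hmul (hw i) hp).const_mul (c i)]
    refine integral_congr_ae (.of_forall fun y => ?_)
    simp only [← mul_assoc, ← Finset.sum_mul]
    rfl
  have hc (i) : c i * (c i * q i) = c i * a i ∧ c i * a i = a i ^ 2 / q i := by
    by_cases hq : q i = 0
    · simp [c, hq]
    · simp only [c]
      constructor <;> field_simp
  have key : 0 ≤ ∫ y, (f y - p y) ^ 2 ∂μ := integral_nonneg fun y => sq_nonneg _
  have expand : ∫ y, (f y - p y) ^ 2 ∂μ =
      ∫ y, f y ^ 2 ∂μ - 2 * ∫ y, f y * p y ∂μ + ∫ y, p y * p y ∂μ := by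
    have h1 : Integrable (fun y => f y ^ 2) μ := hf.integrable_sq
    have h2 : Integrable (fun y => 2 * (f y * p y)) μ := (hmul hf hp).const_mul 2
    have h3 : Integrable (fun y => p y * p y) μ := hmul hp hp
    have h12 : Integrable (fun y => f y ^ 2 - 2 * (f y * p y)) μ := h1.sub h2
    rw [← integral_const_mul, ← integral_sub h1 h2, ← integral_add h12 h3]
    refine integral_congr_ae (.of_forall fun y => ?_)
    simp only
    ring
  rw [expand, hfp, hpp, Finset.sum_congr rfl fun i _ => (hc i).1,
    Finset.sum_congr rfl fun i _ => (hc i).2] at key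
  linarith

/-- Barankin-type bound on the second moment, with test points `x + h` and `x + h + t e_l`,
`l ∈ K`, for a shift `h` vanishing on `K`. -/
lemma sum_sq_diff_ssnmMean_le {N : ℕ} {σ : ℝ} (hσ : 0 < σ) (x h : Fin N → ℝ)
    (K : Finset (Fin N)) (hK : ∀ l ∈ K, h l = 0) {g : (Fin N → ℝ) → ℝ}
    (hg : MemLp g 2 (ssnmP σ x)) (t : ℝ) :
    ssnmMean σ g (x + h) ^ 2 / Real.exp ((∑ i, h i ^ 2) / σ ^ 2) +
      ∑ l ∈ K, (ssnmMean σ g (x + h + t • (Pi.single l (1 : ℝ) : Fin N → ℝ))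
          - ssnmMean σ g (x + h)) ^ 2 /
        (Real.exp ((∑ i, h i ^ 2) / σ ^ 2) * (Real.exp (t ^ 2 / σ ^ 2) - 1))
      ≤ ∫ y, g y ^ 2 ∂ssnmP σ x := by
  set L := shiftDensity (σ ^ 2) x
  set e : Fin N → Fin N → ℝ := fun l => t • Pi.single l 1
  set H := ∑ i, h i ^ 2
  set w : Option (Fin N) → (Fin N → ℝ) → ℝ :=
    fun o => o.elim (L h) fun l => L (h + e l) - L h
  have hL (u) : MemLp (L u) 2 (ssnmP σ x) := memLp_shiftDensity hσ x u
  have hw (o) : MemLp (w o) 2 (ssnmP σ x) := by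
    cases o with
    | none => exact hL h
    | some l => exact (hL _).sub (hL h)
  have hLL (u v) : ∫ y, L u y * L v y ∂ssnmP σ x = Real.exp ((∑ i, u i * v i) / σ ^ 2) :=
    integral_shiftDensity_mul hσ x u v
  have hLi (u v) : Integrable (fun y => L u y * L v y) (ssnmP σ x) :=
    (hL u).integrable_mul (hL v)
  have hgL (u) : ∫ y, g y * L u y ∂ssnmP σ x = ssnmMean σ g (x + u) :=
    (integral_ssnmP_add hσ x u g).symm
  have s0 : ∑ i, h i * h i = H := by simp only [H, sq]
  have s1 (l) (hl : l ∈ K) : ∑ i, h i * (h + e l) i = H := by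
    simp [mul_add, Finset.sum_add_distrib, s0, e, Pi.single_apply, hK l hl]
  have s2 (l) (hl : l ∈ K) (m) (hm : m ∈ K) :
      ∑ i, (h + e l) i * (h + e m) i = H + if l = m then t ^ 2 else 0 := by
    simp only [Pi.add_apply, add_mul, Finset.sum_add_distrib]
    have := s1 m hm
    simp only [Pi.add_apply] at this
    rw [this]
    simp only [e, Pi.smul_apply, Pi.single_apply, smul_eq_mul]
    simp [hK l hl, sq]
  have w0 (l) (hl : l ∈ K) : ∫ y, w none y * w (some l) y ∂ssnmP σ x = 0 := by
    simp only [w, Option.elim, Pi.sub_apply, mul_sub]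
    rw [integral_sub (hLi _ _) (hLi _ _), hLL, hLL, s0, s1 l hl, sub_self]
  have w1 (l) (hl : l ∈ K) (m) (hm : m ∈ K) : ∫ y, w (some l) y * w (some m) y ∂ssnmP σ x =
      Real.exp (H / σ ^ 2) * (Real.exp ((if l = m then t ^ 2 else 0) / σ ^ 2) - 1) := by
    have hz : ∫ y, L h y * w (some m) y ∂ssnmP σ x = 0 := w0 m hm
    have hi : Integrable (fun y => L h y * w (some m) y) (ssnmP σ x) :=
      (hL h).integrable_mul (hw _)
    have hi' : Integrable (fun y => L (h + e l) y * w (some m) y) (ssnmP σ x) :=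
      (hL _).integrable_mul (hw _)
    calc ∫ y, w (some l) y * w (some m) y ∂ssnmP σ x
        = ∫ y, (L (h + e l) y * w (some m) y - L h y * w (some m) y) ∂ssnmP σ x := by
          refine integral_congr_ae (.of_forall fun y => ?_)
          exact sub_mul _ _ _
      _ = ∫ y, L (h + e l) y * w (some m) y ∂ssnmP σ x := by
          rw [integral_sub hi' hi, hz, sub_zero]
      _ = Real.exp ((H + if l = m then t ^ 2 else 0) / σ ^ 2) - Real.exp (H / σ ^ 2) := by
          simp only [w, Option.elim, Pi.sub_apply, mul_sub]
          rw [integral_sub (hLi _ _) (hLi _ _), hLL, hLL, s2 l hl m hm]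
          simp only [mul_comm ((h + e l) _), s1 l hl]
      _ = _ := by rw [add_div, Real.exp_add]; ring
  have horth : ∀ i ∈ K.insertNone, ∀ j ∈ K.insertNone, i ≠ j →
      ∫ y, w i y * w j y ∂ssnmP σ x = 0 := by
    rintro (_ | l) hl (_ | m) hm hne
    · exact absurd rfl hne
    · exact w0 m (Finset.some_mem_insertNone.1 hm)
    · simp only [mul_comm (w (some l) _)]
      exact w0 l (Finset.some_mem_insertNone.1 hl)
    · rw [w1 l (Finset.some_mem_insertNone.1 hl) m (Finset.some_mem_insertNone.1 hm),
        if_neg fun hlm => hne (congrArg some hlm)]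
      simp
  refine le_trans (le_of_eq ?_) (sum_sq_integral_mul_div_le hg K.insertNone hw horth)
  rw [Finset.sum_insertNone]
  congr 1
  · have h0 : ∫ y, w none y * w none y ∂ssnmP σ x = Real.exp (H / σ ^ 2) := by
      rw [← s0]; exact hLL h h
    rw [h0]
    exact congrArg (· ^ 2 / _) (hgL h).symm
  · refine Finset.sum_congr rfl fun l hl => ?_
    rw [w1 l hl l hl, if_pos rfl]
    congr 2
    have hi (u) : Integrable (fun y => g y * L u y) (ssnmP σ x) := hg.integrable_mul (hL u)
    simp only [w, Option.elim, Pi.sub_apply, mul_sub]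
    rw [integral_sub (hi _) (hi _), hgL, hgL, add_assoc]

lemma tendsto_sq_div_exp_sub_one {V : ℝ} (hV : 0 < V) :
    Tendsto (fun t : ℝ => t ^ 2 / (Real.exp (t ^ 2 / V) - 1)) (𝓝[≠] 0) (𝓝 V) := by
  have h1 := (Real.hasDerivAt_exp 0).tendsto_slope_zero
  have h2 : Tendsto (fun t : ℝ => t ^ 2 / V) (𝓝[≠] 0) (𝓝[≠] 0) := by
    refine tendsto_nhdsWithin_iff.2 ⟨tendsto_nhdsWithin_of_tendsto_nhds ?_, ?_⟩
    · have : Continuous fun t : ℝ => t ^ 2 / V := by fun_prop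
      simpa using this.tendsto 0
    · filter_upwards [self_mem_nhdsWithin] with t (ht : t ≠ 0)
      simp [ht, hV.ne']
  have h3 := ((h1.comp h2).inv₀ (by simp)).const_mul V
  simp only [Real.exp_zero, inv_one, mul_one] at h3
  refine h3.congr fun t => ?_
  simp only [Function.comp_apply, zero_add, smul_eq_mul, mul_inv, inv_inv]
  field_simp

/-- Novel CRB-type bound for the SSNM. With `x₀^K` the vector
obtained from `x₀` by zeroing all entries outside `K`, and `b_l` the partial derivatives
of the mean function `γ` at `x₀^K` along `e_l`, `l ∈ K`,
`v(ĝ;x₀) ≥ exp(−(1/σ²) Σ_{l∉K} (x₀)_l²) [σ² Σ_{l∈K} b_l² + γ(x₀^K)²] − γ(x₀)²`. -/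
theorem ssnm_crb_type_bound {N S : ℕ} (hN : 1 ≤ N) (hS1 : 1 ≤ S) (hSN : S ≤ N)
    (σ : ℝ) (hσ : 0 < σ)
    (x₀ : Fin N → ℝ) (hx₀ : x₀ ∈ sparseSet N S)
    (K : Finset (Fin N)) (hKne : K.Nonempty) (hKS : K.card ≤ S)
    (g : (Fin N → ℝ) → ℝ) (hg : Measurable g)
    (hint : ∀ x ∈ sparseSet N S, Integrable g (ssnmP σ x))
    (hsq : Integrable (fun y => g y ^ 2) (ssnmP σ x₀))
    (b : Fin N → ℝ)
    (hder : ∀ l ∈ K, HasDerivAt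
      (fun t : ℝ => ssnmMean σ g
        ((fun i => if i ∈ K then x₀ i else 0) + t • (Pi.single l (1:ℝ) : Fin N → ℝ)))
      (b l) 0) :
    Real.exp (-(1 / σ ^ 2) * ∑ l ∈ Kᶜ, x₀ l ^ 2) *
        (σ ^ 2 * ∑ l ∈ K, b l ^ 2 + ssnmMean σ g (fun i => if i ∈ K then x₀ i else 0) ^ 2)
      - ssnmMean σ g x₀ ^ 2
      ≤ ssnmVar σ g x₀ := by
  set a : Fin N → ℝ := fun i => if i ∈ K then x₀ i else 0
  have hLp : MemLp g 2 (ssnmP σ x₀) :=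
    (memLp_two_iff_integrable_sq hg.aestronglyMeasurable).2 hsq
  have hvar : ssnmVar σ g x₀ = ∫ y, g y ^ 2 ∂ssnmP σ x₀ - ssnmMean σ g x₀ ^ 2 := by
    have := variance_eq_sub hLp
    rwa [variance_eq_integral hg.aemeasurable] at this
  rw [hvar]
  refine sub_le_sub_right ?_ _
  have hK : ∀ l ∈ K, (a - x₀) l = 0 := fun l hl => by simp [a, hl]
  have hH : ∑ i, (a - x₀) i ^ 2 = ∑ l ∈ Kᶜ, x₀ l ^ 2 := by
    rw [← Finset.sum_add_sum_compl K, Finset.sum_eq_zero fun l hl => by simp [hK l hl], zero_add]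
    refine Finset.sum_congr rfl fun l hl => ?_
    simp [a, Finset.mem_compl.1 hl]
  have hbound := sum_sq_diff_ssnmMean_le hσ x₀ (a - x₀) K hK hLp
  rw [hH, add_sub_cancel] at hbound
  set E := Real.exp ((∑ l ∈ Kᶜ, x₀ l ^ 2) / σ ^ 2)
  have hE : Real.exp (-(1 / σ ^ 2) * ∑ l ∈ Kᶜ, x₀ l ^ 2) = E⁻¹ := by
    rw [← Real.exp_neg]
    congr 1
    ring
  have hlim : Tendsto (fun t : ℝ => ssnmMean σ g a ^ 2 / E + ∑ l ∈ K,
      (ssnmMean σ g (a + t • (Pi.single l (1 : ℝ) : Fin N → ℝ)) - ssnmMean σ g a) ^ 2 /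
        (E * (Real.exp (t ^ 2 / σ ^ 2) - 1))) (𝓝[≠] 0)
      (𝓝 (ssnmMean σ g a ^ 2 / E + ∑ l ∈ K, b l ^ 2 * σ ^ 2 / E)) := by
    refine tendsto_const_nhds.add (tendsto_finsetSum _ fun l hl => ?_)
    have h1 := (((hder l hl).tendsto_slope_zero.pow 2).mul
      (tendsto_sq_div_exp_sub_one (V := σ ^ 2) (by positivity))).div_const E
    refine h1.congr' ?_
    filter_upwards [self_mem_nhdsWithin] with t (ht : t ≠ 0)
    simp only [zero_add, zero_smul, add_zero, smul_eq_mul]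
    rw [mul_pow, inv_pow, ← mul_div_assoc, div_div, mul_comm E]
    congr 1
    field_simp
  refine le_trans (le_of_eq ?_) (le_of_tendsto hlim (.of_forall hbound))
  rw [hE, ← Finset.sum_div, ← Finset.sum_mul]
  ring
end
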